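/- For every integer n ≥ 4, n · (n−A_{n−1}−1)! / ((n−2A_{n−1})! · A_{n−1}!) > (n−1) · (n−A_{n−1}−2)! / ((n−1−2A_{n−1})! · A_{n−1}!); consequently the height of the resultant of a generic quadratic with a generic degree-n polynomial is strictly greater than the height of the resultant of a generic quadratic with a generic degree-(n−1) polynomial. -/

import Mathlib

noncomputable section

open MvPolynomial

/-- The quadratic polynomial `p_n(z) = (n-2z+1)(n-2z+2) - z(n-z)`. -/
def pquad (n : ℕ) (z : ℝ) : ℝ :=
  ((n : ℝ) - 2 * z + 1) * ((n : ℝ) - 2 * z + 2) - z * ((n : ℝ) - z)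

/-- The generic Sylvester matrix of a degree-`m` polynomial `f = f₀ + ⋯ + f_m xᵐ` and a
degree-`n` polynomial `g = g₀ + ⋯ + gₙ xⁿ`: its first `n` columns contain the shifted
coefficients of `f` (the indeterminates `Sum.inl i`) and its last `m` columns contain the
shifted coefficients of `g` (the indeterminates `Sum.inr j`). -/
def sylvesterMatrix (m n : ℕ) :
    Matrix (Fin (m + n)) (Fin (m + n)) (MvPolynomial (Fin (m + 1) ⊕ Fin (n + 1)) ℤ) :=
  Matrix.of fun i j =>
    if (j : ℕ) < n then
      if h : (j : ℕ) ≤ (i : ℕ) ∧ (i : ℕ) - (j : ℕ) ≤ m then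
        X (Sum.inl ⟨(i : ℕ) - (j : ℕ), Nat.lt_succ_of_le h.2⟩)
      else 0
    else
      if h : (j : ℕ) - n ≤ (i : ℕ) ∧ (i : ℕ) - ((j : ℕ) - n) ≤ n then
        X (Sum.inr ⟨(i : ℕ) - ((j : ℕ) - n), Nat.lt_succ_of_le h.2⟩)
      else 0

/-- `genRes m n` is the Sylvester resultant `Res(f,g)` of the generic polynomials
`f` of degree `m` and `g` of degree `n`. -/
def genRes (m n : ℕ) : MvPolynomial (Fin (m + 1) ⊕ Fin (n + 1)) ℤ :=
  (sylvesterMatrix m n).det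

/-- The height of an integer multivariate polynomial:
the maximum of the absolute values of its coefficients. -/
def height {σ : Type*} (P : MvPolynomial σ ℤ) : ℕ :=
  P.support.sup fun s => (P.coeff s).natAbs

/-- The absolute value of the coefficient of `s ^ (k - 2 * a) * p ^ a` in the power sum
`α ^ k + β ^ k`, where `s = α + β` and `p = α * β`, for `k ≥ 1`; for `k = 0` the power sum is
replaced by `1`. -/
def lucasCoeff : ℕ → ℕ → ℕ
  | _, 0 => 1
  | 0, _ + 1 => 0
  | 1, _ + 1 => 0
  | 2, 1 => 2
  | 2, _ + 2 => 0
  | k + 3, a + 1 => lucasCoeff (k + 2) (a + 1) + lucasCoeff (k + 1) a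

lemma lucasCoeff_zero_right (k : ℕ) : lucasCoeff k 0 = 1 := by
  rw [lucasCoeff]

lemma lucasCoeff_eq_zero : ∀ {k a : ℕ}, k < 2 * a → lucasCoeff k a = 0
  | _, 0, h => by omega
  | 0, _ + 1, _ => by rw [lucasCoeff]
  | 1, _ + 1, _ => by rw [lucasCoeff]
  | 2, 1, h => by omega
  | 2, _ + 2, _ => by rw [lucasCoeff]
  | k + 3, a + 1, h => by
    rw [lucasCoeff, lucasCoeff_eq_zero (by omega), lucasCoeff_eq_zero (by omega)]

lemma lucasCoeff_pos : ∀ {k a : ℕ}, 2 * a ≤ k → 0 < lucasCoeff k a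
  | _, 0, _ => by simp [lucasCoeff_zero_right]
  | 0, _ + 1, h => by omega
  | 1, _ + 1, h => by omega
  | 2, 1, _ => by simp [lucasCoeff]
  | 2, _ + 2, h => by omega
  | k + 3, a + 1, h => by
    rw [lucasCoeff]
    exact Nat.add_pos_right _ (lucasCoeff_pos (by omega))

lemma lucasCoeff_mono (a : ℕ) : Monotone fun k => lucasCoeff k a := by
  refine monotone_nat_of_le_succ fun k => ?_
  match k, a with
  | _, 0 => simp [lucasCoeff_zero_right]
  | 0, a + 1 => simp [lucasCoeff]
  | 1, a + 1 => simp [lucasCoeff]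
  | k + 2, a + 1 => simp [lucasCoeff]

lemma lucasCoeff_lt_succ {k a : ℕ} (hk : 2 ≤ k) (ha : 1 ≤ a) (hak : 2 * a ≤ k + 1) :
    lucasCoeff k a < lucasCoeff (k + 1) a := by
  obtain ⟨k, rfl⟩ := Nat.exists_eq_add_of_le' hk
  obtain ⟨a, rfl⟩ := Nat.exists_eq_add_of_le' ha
  rw [lucasCoeff]
  exact Nat.lt_add_of_pos_right (lucasCoeff_pos (by omega))

lemma power_sum_eq_sum_lucasCoeff {K : Type*} [CommRing K] (c α β : K) :
    ∀ k N : ℕ, k < 2 * N →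
      ∑ a ∈ Finset.range N, (-1) ^ (k + a) * (lucasCoeff k a : K) *
        (-(c * (α + β))) ^ (k - 2 * a) * (c * α * β * c) ^ a =
      if k = 0 then 1 else c ^ k * (α ^ k + β ^ k)
  | _, 0, h => by omega
  | 0, N + 1, _ => by simp [Finset.sum_range_succ', lucasCoeff]
  | 1, N + 1, _ => by simp [Finset.sum_range_succ', lucasCoeff]
  | 2, 1, h => by omega
  | 2, N + 2, _ => by
    simp [Finset.sum_range_succ', lucasCoeff]
    ring
  | k + 3, N + 1, h => by
    have h1 := power_sum_eq_sum_lucasCoeff c α β (k + 2) (N + 1) (by omega)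
    have h2 := power_sum_eq_sum_lucasCoeff c α β (k + 1) N (by omega)
    rw [if_neg (by omega)] at h1 h2 ⊢
    have h3 : c ^ (k + 3) * (α ^ (k + 3) + β ^ (k + 3)) =
        (c * (α + β)) * (c ^ (k + 2) * (α ^ (k + 2) + β ^ (k + 2))) -
          (c * α * β * c) * (c ^ (k + 1) * (α ^ (k + 1) + β ^ (k + 1))) := by ring
    rw [h3, ← h1, ← h2, Finset.sum_range_succ', Finset.sum_range_succ', mul_add (c * (α + β)),
      Finset.mul_sum, Finset.mul_sum, add_sub_right_comm, ← Finset.sum_sub_distrib]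
    congr 1
    · refine Finset.sum_congr rfl fun a _ => ?_
      rw [lucasCoeff, show k + 3 - 2 * (a + 1) = k + 1 - 2 * a by omega]
      rcases lt_or_ge (k + 2) (2 * (a + 1)) with h | h
      · rw [lucasCoeff_eq_zero h]
        push_cast
        ring
      · obtain ⟨d, hd⟩ := Nat.exists_eq_add_of_le h
        rw [show k + 1 - 2 * a = d + 1 by omega, show k + 2 - 2 * (a + 1) = d by omega]
        push_cast
        ring
    · simp only [lucasCoeff_zero_right, Nat.sub_zero, mul_zero]
      ring

lemma sum_mul_sum_eq_sum_add_swap {K : Type*} [CommRing K] (u v : ℕ → K) (N : ℕ) :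
    (∑ i ∈ Finset.range N, u i) * ∑ i ∈ Finset.range N, v i =
      ∑ j ∈ Finset.range N, ∑ i ∈ Finset.range (j + 1),
        if j - i = 0 then u i * v i else u i * v j + u j * v i := by
  induction N with
  | zero => simp
  | succ N ih =>
    rw [Finset.sum_range_succ u, Finset.sum_range_succ v, Finset.sum_range_succ _ N, ← ih,
      Finset.sum_range_succ _ N, if_pos (Nat.sub_self N)]
    have : ∑ i ∈ Finset.range N, (if N - i = 0 then u i * v i else u i * v N + u N * v i) =
        (∑ i ∈ Finset.range N, u i) * v N + u N * ∑ i ∈ Finset.range N, v i := by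
      rw [Finset.sum_mul, Finset.mul_sum, ← Finset.sum_add_distrib]
      refine Finset.sum_congr rfl fun i hi => ?_
      rw [if_neg (by have := Finset.mem_range.1 hi; omega)]
    rw [this]
    ring

/-- The indices `⟨j, i, a⟩` of the monomials of `genRes 2 n`. -/
def resIndex (n : ℕ) : Finset (Σ _ : ℕ, Σ _ : ℕ, ℕ) :=
  (Finset.range (n + 1)).sigma fun j => (Finset.range (j + 1)).sigma fun i =>
    Finset.range ((j - i) / 2 + 1)

lemma mem_resIndex {n j i a : ℕ} :
    (⟨j, i, a⟩ : Σ _ : ℕ, Σ _ : ℕ, ℕ) ∈ resIndex n ↔ j ≤ n ∧ i ≤ j ∧ 2 * a ≤ j - i := by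
  simp only [resIndex, Finset.mem_sigma, Finset.mem_range]
  omega

/-- The exponent of the monomial of `genRes 2 n` with index `⟨j, i, a⟩`. -/
def resExponent (n : ℕ) (t : Σ _ : ℕ, Σ _ : ℕ, ℕ) : Fin (2 + 1) ⊕ Fin (n + 1) →₀ ℕ :=
  Finsupp.single (Sum.inl 0) (t.2.1 + t.2.2) +
    Finsupp.single (Sum.inl 1) (t.1 - t.2.1 - 2 * t.2.2) +
    Finsupp.single (Sum.inl 2) (n - t.1 + t.2.2) +
    Finsupp.single (Sum.inr (Fin.ofNat (n + 1) t.2.1)) 1 +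
    Finsupp.single (Sum.inr (Fin.ofNat (n + 1) t.1)) 1

/-- The coefficient of the monomial of `genRes 2 n` with index `⟨j, i, a⟩`. -/
def resCoeff (t : Σ _ : ℕ, Σ _ : ℕ, ℕ) : ℤ :=
  (-1) ^ (t.1 - t.2.1 + t.2.2) * lucasCoeff (t.1 - t.2.1) t.2.2

lemma natAbs_resCoeff (j i a : ℕ) : (resCoeff ⟨j, i, a⟩).natAbs = lucasCoeff (j - i) a := by
  simp [resCoeff, Int.natAbs_mul, Int.natAbs_pow]

lemma monomial_resExponent (n : ℕ) (t : Σ _ : ℕ, Σ _ : ℕ, ℕ) (c : ℤ) :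
    monomial (resExponent n t) c =
      C c * X (Sum.inl 0) ^ (t.2.1 + t.2.2) * X (Sum.inl 1) ^ (t.1 - t.2.1 - 2 * t.2.2) *
        X (Sum.inl 2) ^ (n - t.1 + t.2.2) * X (Sum.inr (Fin.ofNat (n + 1) t.2.1)) *
        X (Sum.inr (Fin.ofNat (n + 1) t.1)) := by
  simp only [X_pow_eq_monomial]
  simp only [X, C_apply, monomial_mul, mul_one, zero_add, resExponent]

lemma resExponent_apply_inr {n j i a l : ℕ} (hi : i ≤ n) (hj : j ≤ n) (hl : l ≤ n) :
    resExponent n ⟨j, i, a⟩ (Sum.inr (Fin.ofNat (n + 1) l)) =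
      (if i = l then 1 else 0) + if j = l then 1 else 0 := by
  have hs : ∀ x ≤ n, Finsupp.single (Sum.inr (Fin.ofNat (n + 1) x) : Fin (2 + 1) ⊕ Fin (n + 1)) 1
      (Sum.inr (Fin.ofNat (n + 1) l)) = if x = l then 1 else 0 := by
    intro x hx
    split_ifs with h
    · rw [h, Finsupp.single_eq_same]
    · refine Finsupp.single_eq_of_ne fun he => h ?_
      have h1 := congrArg Fin.val (Sum.inr_injective he)
      rw [Fin.val_ofNat, Fin.val_ofNat, Nat.mod_eq_of_lt (by omega),
        Nat.mod_eq_of_lt (by omega)] at h1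
      exact h1.symm
  have hz : ∀ (y : Fin (2 + 1)) (e : ℕ), Finsupp.single (Sum.inl y : Fin (2 + 1) ⊕ Fin (n + 1)) e
      (Sum.inr (Fin.ofNat (n + 1) l)) = 0 := fun y e => Finsupp.single_eq_of_ne Sum.inr_ne_inl
  simp only [resExponent, Finsupp.add_apply, hz, zero_add]
  rw [hs i hi, hs j hj]

lemma resExponent_injOn (n : ℕ) : Set.InjOn (resExponent n) (resIndex n) := by
  rintro ⟨j, i, a⟩ h ⟨j', i', a'⟩ h' he
  rw [Finset.mem_coe, mem_resIndex] at h h'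
  have h0 : i + a = i' + a' := by
    simpa [resExponent] using DFunLike.congr_fun he (Sum.inl 0)
  have hg : ∀ l ≤ n, (if i = l then 1 else 0) + (if j = l then 1 else 0) =
      (if i' = l then 1 else 0) + (if j' = l then 1 else 0) := by
    intro l hl
    have h1 := DFunLike.congr_fun he (Sum.inr (Fin.ofNat (n + 1) l))
    rwa [resExponent_apply_inr (by omega) (by omega) hl,
      resExponent_apply_inr (by omega) (by omega) hl] at h1
  have hi := hg i (by omega)
  have hj := hg j (by omega)
  have hi' := hg i' (by omega)
  have hj' := hg j' (by omega)
  have hij : i = i' ∧ j = j' := by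
    clear he hg
    grind
  obtain ⟨rfl, rfl⟩ := hij
  obtain rfl : a = a' := by omega
  rfl

lemma height_sum_monomial {σ ι : Type*} (T : Finset ι) (e : ι → σ →₀ ℕ) (c : ι → ℤ)
    (he : Set.InjOn e T) :
    height (∑ t ∈ T, monomial (e t) (c t)) = T.sup fun t => (c t).natAbs := by
  classical
  have key : ∀ t ∈ T, coeff (e t) (∑ t ∈ T, monomial (e t) (c t)) = c t := by
    intro t ht
    rw [coeff_sum, Finset.sum_eq_single_of_mem t ht, coeff_monomial, if_pos rfl]
    intro s hs hst
    rw [coeff_monomial, if_neg fun h => hst (he hs ht h)]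
  refine le_antisymm (Finset.sup_le fun s hs => ?_) (Finset.sup_le fun t ht => ?_)
  · obtain ⟨t, ht, rfl⟩ : ∃ t ∈ T, e t = s := by
      by_contra! h
      refine mem_support_iff.1 hs ?_
      rw [coeff_sum]
      exact Finset.sum_eq_zero fun t ht => by rw [coeff_monomial, if_neg (h t ht)]
    rw [key t ht]
    exact Finset.le_sup (f := fun t => (c t).natAbs) ht
  · rcases eq_or_ne (c t) 0 with h | h
    · simp [h]
    · rw [← key t ht] at h ⊢
      exact Finset.le_sup (f := fun s => (coeff s (∑ t ∈ T, monomial (e t) (c t))).natAbs)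
        (mem_support_iff.2 h)

/-- The generic polynomial of degree `n` whose coefficients are the second group of
indeterminates. -/
def genPoly (n : ℕ) : Polynomial (MvPolynomial (Fin (2 + 1) ⊕ Fin (n + 1)) ℤ) :=
  ∑ i ∈ Finset.range (n + 1), Polynomial.C (X (Sum.inr (Fin.ofNat (n + 1) i))) * Polynomial.X ^ i

/-- The generic quadratic polynomial whose coefficients are the first group of indeterminates. -/
def genQuad (n : ℕ) : Polynomial (MvPolynomial (Fin (2 + 1) ⊕ Fin (n + 1)) ℤ) :=
  Polynomial.C (X (Sum.inl 2)) * Polynomial.X ^ 2 + Polynomial.C (X (Sum.inl 1)) * Polynomial.X +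
    Polynomial.C (X (Sum.inl 0))

lemma coeff_genPoly {n i : ℕ} (hi : i ≤ n) :
    (genPoly n).coeff i = X (Sum.inr ⟨i, Nat.lt_succ_of_le hi⟩) := by
  rw [genPoly, Polynomial.finsetSum_coeff]
  simp only [Polynomial.coeff_C_mul_X_pow]
  rw [Finset.sum_ite_eq, if_pos (Finset.mem_range.2 (Nat.lt_succ_of_le hi))]
  congr 2
  exact Fin.ext (Nat.mod_eq_of_lt (Nat.lt_succ_of_le hi))

lemma coeff_genQuad {n i : ℕ} (hi : i ≤ 2) :
    (genQuad n).coeff i = X (Sum.inl ⟨i, Nat.lt_succ_of_le hi⟩) := by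
  interval_cases i <;> simp [genQuad, Polynomial.coeff_X, Polynomial.coeff_C]

lemma genRes_two_eq_resultant (n : ℕ) :
    genRes 2 n = Polynomial.resultant (genPoly n) (genQuad n) n 2 := by
  rw [genRes, Polynomial.resultant,
    ← Matrix.det_reindex_self (finCongr (Nat.add_comm 2 n)) (sylvesterMatrix 2 n)]
  congr 1
  ext1 i j
  induction j using Fin.addCases with
  | left j =>
    simp only [Matrix.reindex_apply, Matrix.submatrix_apply, sylvesterMatrix, Matrix.of_apply,
      Polynomial.sylvester, Fin.addCases_left, finCongr_symm, finCongr_apply, Fin.val_cast,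
      Fin.val_castAdd, Set.mem_Icc]
    rw [if_pos j.2]
    split_ifs with h1 h2 h2
    · rw [coeff_genQuad h1.2]
    · omega
    · omega
    · rfl
  | right j =>
    simp only [Matrix.reindex_apply, Matrix.submatrix_apply, sylvesterMatrix, Matrix.of_apply,
      Polynomial.sylvester, Fin.addCases_right, finCongr_symm, finCongr_apply, Fin.val_cast,
      Fin.val_natAdd, Set.mem_Icc]
    rw [if_neg (by omega)]
    simp only [Nat.add_sub_cancel_left]
    split_ifs with h1 h2 h2
    · rw [coeff_genPoly h1.2]
    · omega
    · omega
    · rfl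

lemma resultant_quadratic {K : Type*} [CommRing K] [Nontrivial K] (c α β : K)
    (g : Polynomial K) (n : ℕ) (hg : g.natDegree ≤ n) :
    Polynomial.resultant g (Polynomial.C c *
      ((Polynomial.X - Polynomial.C α) * (Polynomial.X - Polynomial.C β))) n 2 =
      c ^ n * (g.eval α * g.eval β) := by
  have h := Polynomial.resultant_mul_left (Polynomial.X - Polynomial.C α)
    (Polynomial.X - Polynomial.C β) g n hg
  have h1 : ∀ r : K, Polynomial.resultant (Polynomial.X - Polynomial.C r) g 1 n = g.eval r := by
    intro r
    have h2 := Polynomial.resultant_X_sub_C_pow_left r g 1 n hg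
    rwa [pow_one, pow_one] at h2
  simp only [Polynomial.natDegree_X_sub_C, h1] at h
  rw [Polynomial.resultant_C_mul_right, Polynomial.resultant_comm, h, mul_comm n 2, pow_mul]
  simp

lemma exists_quadratic_factors {K : Type*} [Field K] [IsAlgClosed K] {c : K} (hc : c ≠ 0)
    (b a : K) : ∃ α β : K, b = -(c * (α + β)) ∧ a = c * α * β := by
  have hd : (Polynomial.C c * Polynomial.X ^ 2 + Polynomial.C b * Polynomial.X +
      Polynomial.C a).degree ≠ 0 := by
    rw [Polynomial.degree_quadratic hc]
    decide
  obtain ⟨α, hα⟩ := IsAlgClosed.exists_root _ hd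
  simp only [Polynomial.IsRoot.def, Polynomial.eval_add, Polynomial.eval_mul, Polynomial.eval_C,
    Polynomial.eval_pow, Polynomial.eval_X] at hα
  refine ⟨α, -b / c - α, by field_simp; ring, ?_⟩
  field_simp
  linear_combination hα

lemma genRes_two_eq_sum (n : ℕ) :
    genRes 2 n = ∑ t ∈ resIndex n, monomial (resExponent n t) (resCoeff t) := by
  let R := MvPolynomial (Fin (2 + 1) ⊕ Fin (n + 1)) ℤ
  let K := AlgebraicClosure (FractionRing R)
  let φ : R →+* K := (algebraMap (FractionRing R) K).comp (algebraMap R (FractionRing R))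
  have hφ : Function.Injective φ :=
    (algebraMap (FractionRing R) K).injective.comp (IsFractionRing.injective R (FractionRing R))
  apply hφ
  have hc : φ (X (Sum.inl 2)) ≠ 0 := (map_ne_zero_iff φ hφ).2 (X_ne_zero _)
  obtain ⟨α, β, hb, ha⟩ :=
    exists_quadratic_factors hc (φ (X (Sum.inl 1))) (φ (X (Sum.inl 0)))
  set c : K := φ (X (Sum.inl 2)) with hcdef
  let G : ℕ → K := fun i => φ (X (Sum.inr (Fin.ofNat (n + 1) i)))
  have hquad : (genQuad n).map φ = Polynomial.C c *
      ((Polynomial.X - Polynomial.C α) * (Polynomial.X - Polynomial.C β)) := by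
    simp only [genQuad, Polynomial.map_add, Polynomial.map_mul, Polynomial.map_pow,
      Polynomial.map_C, Polynomial.map_X, hb, ha, ← hcdef, Polynomial.C_neg, Polynomial.C_mul,
      Polynomial.C_add]
    ring
  have hpoly : (genPoly n).map φ =
      ∑ i ∈ Finset.range (n + 1), Polynomial.C (G i) * Polynomial.X ^ i := by
    simp only [genPoly, Polynomial.map_sum, Polynomial.map_mul, Polynomial.map_pow,
      Polynomial.map_C, Polynomial.map_X, G]
  have hdeg : ((genPoly n).map φ).natDegree ≤ n := by
    rw [hpoly]
    refine Polynomial.natDegree_sum_le_of_forall_le _ _ fun i hi => ?_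
    exact (Polynomial.natDegree_C_mul_X_pow_le _ _).trans
      (Nat.le_of_lt_succ (Finset.mem_range.1 hi))
  have heval : ∀ x : K, ((genPoly n).map φ).eval x = ∑ i ∈ Finset.range (n + 1), G i * x ^ i := by
    intro x
    simp [hpoly, Polynomial.eval_finsetSum]
  rw [genRes_two_eq_resultant, ← Polynomial.resultant_map_map, hquad,
    resultant_quadratic _ _ _ _ _ hdeg, heval, heval, sum_mul_sum_eq_sum_add_swap, resIndex,
    Finset.sum_sigma, map_sum, Finset.mul_sum]
  refine Finset.sum_congr rfl fun j hj => ?_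
  rw [Finset.sum_sigma, map_sum, Finset.mul_sum]
  refine Finset.sum_congr rfl fun i hi => ?_
  rw [Finset.mem_range] at hi hj
  obtain ⟨k, rfl⟩ := Nat.exists_eq_add_of_le (Nat.le_of_lt_succ hi)
  obtain ⟨d, rfl⟩ := Nat.exists_eq_add_of_le (Nat.le_of_lt_succ hj)
  have hsum := power_sum_eq_sum_lucasCoeff c α β k (k / 2 + 1) (by omega)
  have hterm : φ (∑ a ∈ Finset.range (k / 2 + 1),
      monomial (resExponent (i + k + d) ⟨i + k, i, a⟩) (resCoeff ⟨i + k, i, a⟩)) =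
      G i * G (i + k) * (c * α * β) ^ i * c ^ d *
        if k = 0 then 1 else c ^ k * (α ^ k + β ^ k) := by
    rw [← hsum, map_sum, Finset.mul_sum]
    refine Finset.sum_congr rfl fun a _ => ?_
    rw [monomial_resExponent]
    simp only [map_mul, map_pow, hb, ha, ← hcdef, resCoeff, Nat.add_sub_cancel_left, G]
    simp only [map_neg, map_one, map_natCast]
    ring
  rw [Nat.add_sub_cancel_left, hterm]
  split_ifs with hk
  · subst hk
    simp only [Nat.add_zero]
    ring
  · ring

lemma height_genRes_two (n : ℕ) :
    height (genRes 2 n) = (resIndex n).sup fun t => (resCoeff t).natAbs := by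
  rw [genRes_two_eq_sum, height_sum_monomial _ _ _ (resExponent_injOn n)]

lemma lucasCoeff_le_height_genRes_two {n a : ℕ} (ha : 2 * a ≤ n) :
    lucasCoeff n a ≤ height (genRes 2 n) := by
  rw [height_genRes_two]
  have h := Finset.le_sup (f := fun t => (resCoeff t).natAbs)
    (mem_resIndex.2 ⟨le_refl n, Nat.zero_le n, ha⟩)
  simpa only [natAbs_resCoeff, Nat.sub_zero] using h

lemma height_genRes_two_lt_succ {n : ℕ} (hn : 2 ≤ n) :
    height (genRes 2 n) < height (genRes 2 (n + 1)) := by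
  have h1 : 1 < height (genRes 2 (n + 1)) :=
    calc 1 < lucasCoeff 2 1 := by simp [lucasCoeff]
      _ ≤ lucasCoeff (n + 1) 1 := lucasCoeff_mono 1 (by omega)
      _ ≤ _ := lucasCoeff_le_height_genRes_two (by omega)
  rw [height_genRes_two n, Finset.sup_lt_iff (lt_trans zero_lt_one h1)]
  rintro ⟨j, i, a⟩ ht
  rw [mem_resIndex] at ht
  rw [natAbs_resCoeff]
  rcases Nat.eq_zero_or_pos a with rfl | ha
  · rwa [lucasCoeff_zero_right]
  · calc lucasCoeff (j - i) a ≤ lucasCoeff n a := lucasCoeff_mono a (by omega)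
      _ < lucasCoeff (n + 1) a := lucasCoeff_lt_succ hn ha (by omega)
      _ ≤ _ := lucasCoeff_le_height_genRes_two (by omega)

lemma one_le_of_pquad_eq_zero {n : ℕ} (hn : 2 ≤ n) {r : ℝ} (hroot : pquad n r = 0) : 1 ≤ r := by
  have hn' : (2 : ℝ) ≤ n := by exact_mod_cast hn
  unfold pquad at hroot
  by_contra! h
  nlinarith [mul_pos (sub_pos.2 h) (sub_pos.2 h), mul_nonneg (sub_nonneg.2 h.le)
    (sub_nonneg.2 hn'), mul_nonneg (sub_nonneg.2 hn') (sub_nonneg.2 hn')]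

lemma mul_factorial_div_lt {n A : ℕ} (hn : 3 ≤ n) (hA : 1 ≤ A) (hAn : 2 * A ≤ n - 1) :
    ((n : ℝ) - 1) * (Nat.factorial (n - A - 2)) /
        (Nat.factorial (n - 1 - 2 * A) * Nat.factorial A) <
      (n : ℝ) * (Nat.factorial (n - A - 1)) /
        (Nat.factorial (n - 2 * A) * Nat.factorial A) := by
  obtain ⟨d, rfl⟩ : ∃ d, n = 2 * A + d + 1 := ⟨n - 1 - 2 * A, by omega⟩
  rw [show 2 * A + d + 1 - A - 1 = (2 * A + d + 1 - A - 2) + 1 by omega,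
    show 2 * A + d + 1 - 2 * A = d + 1 by omega, show 2 * A + d + 1 - 1 - 2 * A = d by omega,
    Nat.factorial_succ, Nat.factorial_succ, show 2 * A + d + 1 - A - 2 + 1 = A + d by omega,
    div_lt_div_iff₀ (by positivity) (by positivity)]
  have hpos : (0 : ℝ) < (Nat.factorial (2 * A + d + 1 - A - 2)) * Nat.factorial d *
      Nat.factorial A := by positivity
  have hA' : (1 : ℝ) ≤ A := by exact_mod_cast hA
  have hn' : (3 : ℝ) ≤ 2 * A + d + 1 := by exact_mod_cast hn
  have hlt : 0 < (A : ℝ) * (2 * A + d - 1) := mul_pos (by linarith) (by linarith)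
  push_cast
  nlinarith [mul_pos hlt hpos]

/-- For every `n ≥ 4` (with `A = A_{n-1}` the floor of the unique root of `p_{n-1}` in
`[0,(n-1)/2]`), `n ⬝ (n-A-1)!/((n-2A)!⬝A!) > (n-1) ⬝ (n-A-2)!/((n-1-2A)!⬝A!)`;
consequently the height of the resultant of a generic quadratic with a generic degree-`n`
polynomial is strictly greater than the one with a generic degree-`(n-1)` polynomial. -/
theorem height_quadratic_strict_mono (n : ℕ) (hn : 4 ≤ n) (r : ℝ)
    (hr : r ∈ Set.Icc 0 (((n - 1 : ℕ) : ℝ) / 2)) (hroot : pquad (n - 1) r = 0)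
    (A : ℕ) (hA : (A : ℤ) = ⌊r⌋) :
    (n : ℝ) * (Nat.factorial (n - A - 1)) /
        (Nat.factorial (n - 2 * A) * Nat.factorial A) >
      ((n : ℝ) - 1) * (Nat.factorial (n - A - 2)) /
        (Nat.factorial (n - 1 - 2 * A) * Nat.factorial A) ∧
    height (genRes 2 n) > height (genRes 2 (n - 1)) := by
  have hr1 : 1 ≤ r := one_le_of_pquad_eq_zero (by omega) hroot
  have hA1 : 1 ≤ A := by
    have : (1 : ℤ) ≤ ⌊r⌋ := Int.le_floor.2 (by exact_mod_cast hr1)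
    omega
  have hAr : (A : ℝ) ≤ r := by
    have : ((A : ℤ) : ℝ) ≤ r := hA ▸ Int.floor_le r
    exact_mod_cast this
  have hAn : 2 * A ≤ n - 1 := by
    have : (2 : ℝ) * A ≤ (n - 1 : ℕ) := by linarith [hr.2]
    exact_mod_cast this
  refine ⟨mul_factorial_div_lt (by omega) hA1 hAn, ?_⟩
  obtain ⟨m, rfl⟩ := Nat.exists_eq_add_of_le' (show 1 ≤ n by omega)
  exact height_genRes_two_lt_succ (by omega)
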